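/- Let p be a prime number and k ≥ 1 a natural number, and let N = p^k. Then the defect of the Fourier matrix satisfies d(F_{p^k}) = p^{k−1}·((p−1)k − p) + 1. -/

import Mathlib

open Matrix ComplexConjugate

noncomputable section

/-- The real vector space `S(U)` of real `N×N` matrices `R` such that for all `i < j`,
`∑ k, U i k * conj (U j k) * (R i k - R j k) = 0`. -/
def defectSpace {N : ℕ} (U : Matrix (Fin N) (Fin N) ℂ) :
    Submodule ℝ (Matrix (Fin N) (Fin N) ℝ) where
  carrier := {R | ∀ i j : Fin N, i < j →
    ∑ k, U i k * conj (U j k) * ((R i k : ℂ) - (R j k : ℂ)) = 0}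
  zero_mem' := by
    intro i j hij
    simp
  add_mem' := by
    intro R R' hR hR' i j hij
    have h1 := hR i j hij
    have h2 := hR' i j hij
    have key : ∀ k, U i k * conj (U j k) * (((R + R') i k : ℂ) - ((R + R') j k : ℂ))
        = U i k * conj (U j k) * ((R i k : ℂ) - (R j k : ℂ))
          + U i k * conj (U j k) * ((R' i k : ℂ) - (R' j k : ℂ)) := by
      intro k
      simp only [Matrix.add_apply]
      push_cast
      ring
    rw [Finset.sum_congr rfl fun k _ => key k, Finset.sum_add_distrib, h1, h2, add_zero]
  smul_mem' := by
    intro c R hR i j hij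
    have h1 := hR i j hij
    have key : ∀ k, U i k * conj (U j k) * (((c • R) i k : ℂ) - ((c • R) j k : ℂ))
        = (c : ℂ) * (U i k * conj (U j k) * ((R i k : ℂ) - (R j k : ℂ))) := by
      intro k
      simp only [Matrix.smul_apply, smul_eq_mul]
      push_cast
      ring
    rw [Finset.sum_congr rfl fun k _ => key k, ← Finset.mul_sum, h1, mul_zero]

/-- The defect of a unitary matrix `U`: `d(U) = dim_ℝ S(U) - (2N - 1)`. -/
def defect {N : ℕ} (U : Matrix (Fin N) (Fin N) ℂ) : ℕ :=
  Module.finrank ℝ (defectSpace U) - (2 * N - 1)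

/-- The Fourier matrix `F_N`, with entries `exp(2πi(i-1)(j-1)/N)/√N` (0-based indexing). -/
def fourierMatrix (N : ℕ) : Matrix (Fin N) (Fin N) ℂ :=
  Matrix.of fun i j : Fin N =>
    Complex.exp (2 * Real.pi * Complex.I * (i : ℕ) * (j : ℕ) / N) / (Real.sqrt N : ℝ)

open ZMod in
/-- The Hartley kernel `cos + sin` evaluated along the standard additive character of `ZMod N`. -/
def hartley {N : ℕ} [NeZero N] (x : ZMod N) : ℝ :=
  (stdAddChar x).re + (stdAddChar x).im

open ZMod in
lemma hartley_mul {N : ℕ} [NeZero N] (x y : ZMod N) :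
    hartley x * hartley y = (stdAddChar (x - y)).re + (stdAddChar (x + y)).im := by
  rw [sub_eq_add_neg, AddChar.map_add_eq_mul, AddChar.map_add_eq_mul, AddChar.map_neg_eq_conj]
  simp only [hartley, Complex.mul_re, Complex.mul_im, Complex.conj_re, Complex.conj_im]
  ring

lemma sum_hartley_mul {N : ℕ} [NeZero N] (a b : ZMod N) :
    ∑ x, hartley (x * a) * hartley (x * b) = if a = b then (N : ℝ) else 0 := by
  have h (c : ZMod N) := AddChar.sum_mulShift c (ZMod.isPrimitive_stdAddChar N)
  simp only [hartley_mul, ← mul_sub, ← mul_add, Finset.sum_add_distrib, ← Complex.re_sum,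
    ← Complex.im_sum, h, ZMod.card, Complex.natCast_re, Complex.natCast_im, add_zero, sub_eq_zero]
  split_ifs <;> simp

lemma sum_hartley_mul_sum_hartley {N : ℕ} [NeZero N] (f : ZMod N → ℝ) (a : ZMod N) :
    ∑ x, hartley (x * a) * ∑ y, hartley (x * y) * f y = N * f a := by
  simp only [Finset.mul_sum]
  rw [Finset.sum_comm]
  simp only [← mul_assoc, ← Finset.sum_mul, sum_hartley_mul, ite_mul, zero_mul]
  simp

open ZMod in
/-- A Fourier coefficient of a real function vanishes iff the Hartley coefficients at the
frequency and its opposite do. -/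
lemma sum_stdAddChar_mul_eq_zero_iff {N : ℕ} [NeZero N] (f : ZMod N → ℝ) (m : ZMod N) :
    ∑ x, stdAddChar (m * x) * (f x : ℂ) = 0 ↔
      ∑ x, hartley (m * x) * f x = 0 ∧ ∑ x, hartley (-m * x) * f x = 0 := by
  have h (x : ZMod N) : stdAddChar (-(m * x)) = conj (stdAddChar (m * x)) :=
    AddChar.map_neg_eq_conj _ _
  simp only [hartley, h, Complex.ext_iff, Complex.re_sum, Complex.im_sum, Complex.re_mul_ofReal,
    Complex.im_mul_ofReal, Complex.conj_re, Complex.conj_im, add_mul, neg_mul,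
    Finset.sum_add_distrib, Finset.sum_neg_distrib, Complex.zero_re, Complex.zero_im]
  constructor <;> rintro ⟨h₁, h₂⟩ <;> constructor <;> linarith

/-- The bijection of `Fin N` with `ZMod N` given by the natural number cast. -/
def finEquivZMod (N : ℕ) [NeZero N] : Fin N ≃ ZMod N where
  toFun i := ((i : ℕ) : ZMod N)
  invFun x := ⟨x.val, x.val_lt⟩
  left_inv i := Fin.ext (ZMod.val_cast_of_lt i.isLt)
  right_inv x := ZMod.natCast_zmod_val x

open ZMod in
lemma fourierMatrix_apply {N : ℕ} [NeZero N] (i j : Fin N) :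
    fourierMatrix N i j =
      stdAddChar (finEquivZMod N i * finEquivZMod N j) / (Real.sqrt N : ℝ) := by
  have h := stdAddChar_coe (N := N) ((i : ℕ) * (j : ℕ) : ℤ)
  push_cast at h
  simp only [finEquivZMod, Equiv.coe_fn_mk, h, fourierMatrix, Matrix.of_apply, mul_assoc]

open ZMod in
lemma fourierMatrix_mul_conj {N : ℕ} [NeZero N] (i j k : Fin N) :
    fourierMatrix N i k * conj (fourierMatrix N j k) =
      (N : ℂ)⁻¹ *
        stdAddChar ((finEquivZMod N i - finEquivZMod N j) * finEquivZMod N k) := by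
  have hN : ((Real.sqrt N : ℝ) : ℂ) * (Real.sqrt N : ℝ) = N := by
    rw [← Complex.ofReal_mul, Real.mul_self_sqrt (Nat.cast_nonneg N), Complex.ofReal_natCast]
  rw [fourierMatrix_apply, fourierMatrix_apply, map_div₀, Complex.conj_ofReal, div_mul_div_comm, hN,
    ← AddChar.map_neg_eq_conj, ← AddChar.map_add_eq_mul, ← sub_eq_add_neg, ← sub_mul,
    div_eq_inv_mul]

/-- The row-wise Hartley transform of a real matrix, indexed by frequency first. -/
def hartleyTransform (N : ℕ) [NeZero N] :
    Matrix (Fin N) (Fin N) ℝ ≃ₗ[ℝ] (ZMod N → ZMod N → ℝ) where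
  toFun R m i := ∑ x, hartley (m * x) * R ((finEquivZMod N).symm i) ((finEquivZMod N).symm x)
  map_add' R R' := by
    ext m i
    simp [mul_add, Finset.sum_add_distrib]
  map_smul' c R := by
    ext m i
    simp [Finset.mul_sum, mul_left_comm]
  invFun g := Matrix.of fun a b =>
    (N : ℝ)⁻¹ * ∑ m, hartley (m * finEquivZMod N b) * g m (finEquivZMod N a)
  left_inv R := by
    ext a b
    have hN : (N : ℝ) ≠ 0 := NeZero.ne _
    have h := sum_hartley_mul_sum_hartley
      (fun x => R a ((finEquivZMod N).symm x)) (finEquivZMod N b)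
    rw [Equiv.symm_apply_apply] at h
    simp only [Matrix.of_apply, Equiv.symm_apply_apply]
    rw [inv_mul_eq_iff_eq_mul₀ hN, h]
  right_inv g := by
    ext m i
    have hN : (N : ℝ) ≠ 0 := NeZero.ne _
    have h := sum_hartley_mul_sum_hartley (fun m => g m i) m
    simp only [mul_comm _ m] at h
    simp only [Matrix.of_apply, Equiv.apply_symm_apply, mul_left_comm _ (N : ℝ)⁻¹,
      ← Finset.mul_sum]
    rw [inv_mul_eq_iff_eq_mul₀ hN, ← h]
    exact Finset.sum_congr rfl fun x _ => by simp only [mul_comm]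

lemma mem_defectSpace_fourierMatrix {N : ℕ} [NeZero N] (R : Matrix (Fin N) (Fin N) ℝ) :
    R ∈ defectSpace (fourierMatrix N) ↔
      ∀ i j : ZMod N, hartleyTransform N R (i - j) i = hartleyTransform N R (i - j) j := by
  have hN : (N : ℂ)⁻¹ ≠ 0 := inv_ne_zero (NeZero.ne _)
  have key (i j : Fin N) :
      ∑ k, fourierMatrix N i k * conj (fourierMatrix N j k) * ((R i k : ℂ) - (R j k : ℂ)) = 0 ↔
        hartleyTransform N R (finEquivZMod N i - finEquivZMod N j) (finEquivZMod N i) =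
            hartleyTransform N R (finEquivZMod N i - finEquivZMod N j) (finEquivZMod N j) ∧
          hartleyTransform N R (finEquivZMod N j - finEquivZMod N i) (finEquivZMod N j) =
            hartleyTransform N R (finEquivZMod N j - finEquivZMod N i) (finEquivZMod N i) := by
    have h := sum_stdAddChar_mul_eq_zero_iff
      (fun x => R i ((finEquivZMod N).symm x) - R j ((finEquivZMod N).symm x))
      (finEquivZMod N i - finEquivZMod N j)
    simp only [fourierMatrix_mul_conj, mul_assoc, ← Finset.mul_sum, mul_eq_zero, hN, false_or]
    rw [← (finEquivZMod N).symm.sum_comp]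
    simp only [Equiv.apply_symm_apply, ← Complex.ofReal_sub]
    rw [h, neg_sub]
    simp only [hartleyTransform, LinearEquiv.coe_mk, LinearMap.coe_mk, AddHom.coe_mk,
      Equiv.symm_apply_apply, mul_sub, Finset.sum_sub_distrib, sub_eq_zero]
    exact and_congr_right fun _ => eq_comm
  constructor
  · intro h i j
    obtain ⟨a, rfl⟩ := (finEquivZMod N).surjective i
    obtain ⟨b, rfl⟩ := (finEquivZMod N).surjective j
    rcases lt_trichotomy a b with hab | rfl | hab
    · exact ((key a b).1 (h a b hab)).1
    · rfl
    · exact ((key b a).1 (h b a hab)).2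
  · exact fun h i j _ => (key i j).2 ⟨h _ _, h _ _⟩

/-- Families of functions on the quotients `G ⧸ ⟨m⟩`, pulled back to families of functions
on `G`. -/
def zmultiplesPullback (G : Type*) [AddCommGroup G] :
    ((Σ m : G, G ⧸ AddSubgroup.zmultiples m) → ℝ) →ₗ[ℝ] (G → G → ℝ) where
  toFun f m i := f ⟨m, (i : G ⧸ AddSubgroup.zmultiples m)⟩
  map_add' _ _ := rfl
  map_smul' _ _ := rfl

lemma zmultiplesPullback_injective (G : Type*) [AddCommGroup G] :
    Function.Injective (zmultiplesPullback G) := by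
  rintro f g h
  ext ⟨m, q⟩
  induction q using QuotientAddGroup.induction_on with
  | H i => exact congrFun (congrFun h m) i

lemma mem_range_zmultiplesPullback {G : Type*} [AddCommGroup G] (g : G → G → ℝ) :
    g ∈ (zmultiplesPullback G).range ↔ ∀ i j : G, g (i - j) i = g (i - j) j := by
  constructor
  · rintro ⟨f, rfl⟩ i j
    have h : (i : G ⧸ AddSubgroup.zmultiples (i - j)) = j :=
      QuotientAddGroup.eq_iff_sub_mem.2 (AddSubgroup.mem_zmultiples _)
    simp only [zmultiplesPullback, LinearMap.coe_mk, AddHom.coe_mk, h]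
  · intro h
    have hper (m : G) : Function.Periodic (g m) m := fun i => by
      simpa using h (i + m) i
    refine ⟨fun q => Quotient.liftOn' q.2 (g q.1) ?_, rfl⟩
    intro i j hij
    obtain ⟨n, hn⟩ := AddSubgroup.mem_zmultiples_iff.1 (QuotientAddGroup.leftRel_apply.1 hij)
    have := ((hper q.1).zsmul n) i
    rw [hn] at this
    simpa using this.symm

lemma finrank_defectSpace_fourierMatrix (N : ℕ) [NeZero N] :
    Module.finrank ℝ (defectSpace (fourierMatrix N)) =
      ∑ m : ZMod N, (AddSubgroup.zmultiples m).index := by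
  classical
  have h : defectSpace (fourierMatrix N) =
      (zmultiplesPullback (ZMod N)).range.comap (hartleyTransform N).toLinearMap := by
    ext R
    rw [mem_defectSpace_fourierMatrix, Submodule.mem_comap, mem_range_zmultiplesPullback]
    rfl
  rw [h, ((hartleyTransform N).ofSubmodule' _).finrank_eq,
    LinearMap.finrank_range_of_inj (zmultiplesPullback_injective _),
    Module.finrank_fintype_fun_eq_card, Fintype.card_sigma]
  simp only [AddSubgroup.index, Nat.card_eq_fintype_card]

lemma sum_index_zmultiples (N : ℕ) [NeZero N] :
    ∑ m : ZMod N, (AddSubgroup.zmultiples m).index = ∑ d ∈ N.divisors, d.totient * (N / d) := by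
  have hindex (m : ZMod N) : (AddSubgroup.zmultiples m).index = N / addOrderOf m := by
    have h := (AddSubgroup.zmultiples m).card_mul_index
    rw [Nat.card_zmultiples, Nat.card_zmod] at h
    exact (Nat.div_eq_of_eq_mul_right (addOrderOf_pos m) h.symm).symm
  have hmaps : ∀ m ∈ (Finset.univ : Finset (ZMod N)), addOrderOf m ∈ N.divisors := fun m _ =>
    Nat.mem_divisors.2 ⟨by simpa [ZMod.card] using addOrderOf_dvd_card (x := m), NeZero.ne N⟩
  rw [← Finset.sum_fiberwise_of_maps_to hmaps]
  refine Finset.sum_congr rfl fun d hd => ?_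
  rw [← IsAddCyclic.card_addOrderOf_eq_totient (α := ZMod N) (d := d)
    (by simpa [ZMod.card] using Nat.dvd_of_mem_divisors hd), ← smul_eq_mul, ← Finset.sum_const]
  refine Finset.sum_congr rfl fun m hm => ?_
  rw [hindex, (Finset.mem_filter.1 hm).2]

lemma sum_totient_mul_div_prime_pow {p : ℕ} (hp : p.Prime) (n : ℕ) :
    ∑ d ∈ (p ^ (n + 1)).divisors, d.totient * (p ^ (n + 1) / d) =
      p ^ (n + 1) + (n + 1) * (p ^ n * (p - 1)) := by
  rw [Nat.sum_divisors_prime_pow hp, Finset.sum_range_succ']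
  have h : ∀ j ∈ Finset.range (n + 1),
      (p ^ (j + 1)).totient * (p ^ (n + 1) / p ^ (j + 1)) = p ^ n * (p - 1) := by
    intro j hj
    have hj : j ≤ n := Nat.lt_succ_iff.1 (Finset.mem_range.1 hj)
    rw [Nat.totient_prime_pow_succ hp, Nat.pow_div (by lia) hp.pos, Nat.add_sub_add_right,
      mul_right_comm, ← pow_add, Nat.add_sub_cancel' hj]
  rw [Finset.sum_congr rfl h]
  simp [add_comm]

/-- For a prime `p` and `k ≥ 1`: `d(F_{p^k}) = p^{k-1}·((p-1)k - p) + 1`. -/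
theorem defect_fourier_prime_power (p k : ℕ) (hp : p.Prime) (hk : 1 ≤ k) :
    (defect (fourierMatrix (p ^ k)) : ℤ) =
      (p : ℤ) ^ (k - 1) * (((p : ℤ) - 1) * k - p) + 1 := by
  obtain ⟨n, rfl⟩ : ∃ n, k = n + 1 := ⟨k - 1, by lia⟩
  obtain ⟨q, rfl⟩ : ∃ q, p = q + 1 := ⟨p - 1, by have := hp.pos; lia⟩
  have : NeZero ((q + 1) ^ (n + 1)) := ⟨pow_ne_zero _ hp.ne_zero⟩
  have hq : 1 ≤ q := by have := hp.two_le; lia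
  have hle : 2 * (q + 1) ^ (n + 1) - 1 ≤
      (q + 1) ^ (n + 1) + (n + 1) * ((q + 1) ^ n * q) := by
    have : (q + 1) ^ n ≤ 1 + n * ((q + 1) ^ n * q) := by
      rcases n with _ | n
      · simp
      · nlinarith [Nat.zero_le (n * ((q + 1) ^ (n + 1) * q)),
          Nat.le_mul_of_pos_right ((q + 1) ^ (n + 1)) hq]
    rw [pow_succ]
    lia
  rw [defect, finrank_defectSpace_fourierMatrix, sum_index_zmultiples,
    sum_totient_mul_div_prime_pow hp, Nat.add_sub_cancel, Nat.add_sub_cancel, Nat.cast_sub hle,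
    Nat.cast_sub (by have := Nat.pos_of_neZero ((q + 1) ^ (n + 1)); lia)]
  push_cast
  ring

end
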